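/- arXiv:2404.03604 — 8 statements merged into one kernel-verified Lean document; each statement's English description precedes it below -/
import Mathlib

section
/- Let S2 ⊆ S1 ⊆ {1,…,n} and let K = S1 \ S2. (i) If r_k ≥ R(S1) for every k ∈ K, then R(S1) ≥ R(S2). (ii) If r_k ≥ R(S2) for every k ∈ K, then R(S1) ≥ R(S2). -/
open Finset

/-- MNL expected revenue of assortment `S`:
`R(S) = ∑_{i∈S} r_i · v_i / (1 + ∑_{k∈S} v_k)` (outside option weight `v₀ = 1`). -/
noncomputable def Rev {n : ℕ} (r v : Fin n → ℝ) (S : Finset (Fin n)) : ℝ :=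
  ∑ i ∈ S, r i * (v i / (1 + ∑ k ∈ S, v k))

/-- Clearing denominators: revenue times total weight is the weighted sum of prices. -/
lemma Rev_mul_weight {n : ℕ} (r v : Fin n → ℝ) (S : Finset (Fin n))
    (hW : 1 + ∑ k ∈ S, v k ≠ 0) :
    Rev r v S * (1 + ∑ k ∈ S, v k) = ∑ i ∈ S, r i * v i := by
  rw [Rev, Finset.sum_mul]
  refine Finset.sum_congr rfl fun i _ => ?_
  field_simp

theorem stmt0 {n : ℕ} (hn : 1 ≤ n) (r v : Fin n → ℝ)
    (hr : ∀ i j : Fin n, i ≤ j → r j ≤ r i) (hr0 : ∀ i, 0 ≤ r i)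
    (hv : ∀ i, 0 < v i)
    (S1 S2 : Finset (Fin n)) (hS : S2 ⊆ S1) :
    ((∀ k ∈ S1 \ S2, Rev r v S1 ≤ r k) → Rev r v S2 ≤ Rev r v S1) ∧
    ((∀ k ∈ S1 \ S2, Rev r v S2 ≤ r k) → Rev r v S2 ≤ Rev r v S1) := by
  have weight_pos (S : Finset (Fin n)) : 0 < 1 + ∑ k ∈ S, v k := by
    have := Finset.sum_nonneg fun k (_ : k ∈ S) => (hv k).le
    linarith
  have rev_S1 := Rev_mul_weight r v S1 (weight_pos S1).ne'
  have rev_S2 := Rev_mul_weight r v S2 (weight_pos S2).ne'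
  have weight_split := Finset.sum_sdiff (f := v) hS
  have price_split := Finset.sum_sdiff (f := fun i => r i * v i) hS
  have price_bound (c : ℝ) (hc : ∀ k ∈ S1 \ S2, c ≤ r k) :
      c * ∑ k ∈ S1 \ S2, v k ≤ ∑ k ∈ S1 \ S2, r k * v k := by
    rw [Finset.mul_sum]
    exact Finset.sum_le_sum fun k hk => mul_le_mul_of_nonneg_right (hc k hk) (hv k).le
  constructor <;> intro h
  · refine le_of_mul_le_mul_right ?_ (weight_pos S2)
    have := price_bound _ h
    rw [← weight_split] at rev_S1
    linarith
  · refine le_of_mul_le_mul_right ?_ (weight_pos S1)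
    have := price_bound _ h
    rw [rev_S1, ← weight_split]
    linarith
end

section
/- For any inventory vector c ∈ ℝ_{≥0}^n and any T ≥ 0, sup{ f^FP(x,T) : x ∈ ℝ_{≥0}^n, x_i ≤ c_i for all i } = f_LP(c,T). Moreover, if y* = (y*_0, y*_1, …, y*_n) is an optimal solution of the sales-based CDLP for (c,T) and x*_i = y*_i for all 1 ≤ i ≤ n, then f^FP(x*,T) = f_LP(c,T), so the supremum is attained at x*. -/
open Finset

/-- The no-purchase fluid quantity `Z₀^FP(x,T)`: the unique `z ≥ 0` with
`z + ∑ i min(vᵢ z, xᵢ) = T` (we take the infimum of the solution set, which is a singleton). -/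
noncomputable def Z0FP {n : ℕ} (v x : Fin n → ℝ) (T : ℝ) : ℝ :=
  sInf {z : ℝ | 0 ≤ z ∧ z + ∑ i, min (v i * z) (x i) = T}

/-- Fluid consumption of product `i`: `Z_i^FP(x,T) = min(vᵢ Z₀^FP(x,T), xᵢ)`. -/
noncomputable def ZFP {n : ℕ} (v x : Fin n → ℝ) (i : Fin n) (T : ℝ) : ℝ :=
  min (v i * Z0FP v x T) (x i)

/-- Fluid revenue `f^FP(x,T) = ∑ i rᵢ Z_i^FP(x,T)`. -/
noncomputable def fFP {n : ℕ} (r v x : Fin n → ℝ) (T : ℝ) : ℝ :=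
  ∑ i, r i * ZFP v x i T

/-- Feasibility for the sales-based CDLP with inventory `c` and horizon `T`:
`y ≥ 0`, `∑ i yᵢ + y₀ = T`, `yᵢ ≤ cᵢ`, and `yᵢ ≤ vᵢ y₀`. -/
def feasibleLP {n : ℕ} (v c : Fin n → ℝ) (T : ℝ) (y0 : ℝ) (y : Fin n → ℝ) : Prop :=
  0 ≤ y0 ∧ (∀ i, 0 ≤ y i) ∧ (∑ i, y i) + y0 = T ∧ (∀ i, y i ≤ c i) ∧ ∀ i, y i ≤ v i * y0

/-- Sales-based CDLP value `f_LP(c,T)` (the feasible region is a nonempty compact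
polytope, so this supremum is attained). -/
noncomputable def fLP {n : ℕ} (r v c : Fin n → ℝ) (T : ℝ) : ℝ :=
  sSup {s : ℝ | ∃ y0 : ℝ, ∃ y : Fin n → ℝ, feasibleLP v c T y0 y ∧ s = ∑ i, r i * y i}

/-- A nonnegative solution of the fluid balance equation is the no-purchase quantity. -/
theorem Z0FP_eq {n : ℕ} {v x : Fin n → ℝ} {T z : ℝ} (hv : ∀ i, 0 ≤ v i) (hz : 0 ≤ z)
    (h : z + ∑ i, min (v i * z) (x i) = T) : Z0FP v x T = z := by
  have hmono : StrictMono fun w : ℝ => w + ∑ i, min (v i * w) (x i) :=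
    strictMono_id.add_monotone fun a b hab => Finset.sum_le_sum fun i _ =>
      min_le_min_right _ (mul_le_mul_of_nonneg_left hab (hv i))
  have hset : {w : ℝ | 0 ≤ w ∧ w + ∑ i, min (v i * w) (x i) = T} = {z} := by
    ext w
    constructor
    · rintro ⟨-, hw⟩
      exact hmono.injective (hw.trans h.symm)
    · rintro rfl
      exact ⟨hz, h⟩
  rw [Z0FP, hset, csInf_singleton]

/-- The fluid balance equation has a nonnegative solution. -/
theorem exists_fluid_balance {n : ℕ} {v x : Fin n → ℝ} {T : ℝ} (hv : ∀ i, 0 ≤ v i)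
    (hx : ∀ i, 0 ≤ x i) (hT : 0 ≤ T) :
    ∃ z, 0 ≤ z ∧ z + ∑ i, min (v i * z) (x i) = T := by
  have hcont : ContinuousOn (fun w : ℝ => w + ∑ i, min (v i * w) (x i)) (Set.Icc 0 T) := by
    fun_prop
  obtain ⟨z, hz, h⟩ := intermediate_value_Icc hT hcont (show T ∈ Set.Icc _ _ from
    ⟨by simpa [hx] using hT, le_add_of_nonneg_right <| Finset.sum_nonneg fun i _ =>
      le_min (mul_nonneg (hv i) hT) (hx i)⟩)
  exact ⟨z, hz.1, h⟩

/-- The fluid consumptions are feasible for the sales-based CDLP. -/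
theorem feasibleLP_fluid {n : ℕ} {v x c : Fin n → ℝ} {T : ℝ} (hv : ∀ i, 0 ≤ v i)
    (hx : ∀ i, 0 ≤ x i) (hxc : ∀ i, x i ≤ c i) (hT : 0 ≤ T) :
    feasibleLP v c T (Z0FP v x T) fun i => ZFP v x i T := by
  obtain ⟨z, hz, h⟩ := exists_fluid_balance hv hx hT
  simp only [ZFP, Z0FP_eq hv hz h]
  exact ⟨hz, fun i => le_min (mul_nonneg (hv i) hz) (hx i), by rw [add_comm, h],
    fun i => (min_le_right _ _).trans (hxc i), fun i => min_le_left _ _⟩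

/-- With a feasible sales vector as inventory, the fluid process sells exactly that vector. -/
theorem ZFP_of_feasibleLP {n : ℕ} {v c y : Fin n → ℝ} {T y0 : ℝ} (hv : ∀ i, 0 ≤ v i)
    (h : feasibleLP v c T y0 y) (i : Fin n) : ZFP v y i T = y i := by
  obtain ⟨h0, -, hsum, -, hle⟩ := h
  rw [ZFP, Z0FP_eq hv h0 (by simp only [min_eq_right (hle _)]; rw [add_comm, hsum]),
    min_eq_right (hle i)]

theorem le_fLP {n : ℕ} {r v c y : Fin n → ℝ} {T y0 : ℝ} (hr : ∀ i, 0 ≤ r i)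
    (h : feasibleLP v c T y0 y) : ∑ i, r i * y i ≤ fLP r v c T := by
  refine le_csSup ⟨∑ i, r i * c i, ?_⟩ ⟨y0, y, h, rfl⟩
  rintro _ ⟨w0, w, hw, rfl⟩
  exact Finset.sum_le_sum fun i _ => mul_le_mul_of_nonneg_left (hw.2.2.2.1 i) (hr i)

theorem stmt3 {n : ℕ} (hn : 1 ≤ n) (r v : Fin n → ℝ)
    (hr : ∀ i j : Fin n, i ≤ j → r j ≤ r i) (hr0 : ∀ i, 0 ≤ r i)
    (hv : ∀ i, 0 < v i)
    (c : Fin n → ℝ) (hc : ∀ i, 0 ≤ c i) (T : ℝ) (hT : 0 ≤ T)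
    (y0 : ℝ) (ystar : Fin n → ℝ)
    (hfeas : feasibleLP v c T y0 ystar)
    (hopt : ∑ i, r i * ystar i = fLP r v c T) :
    sSup {s : ℝ | ∃ x : Fin n → ℝ, (∀ i, 0 ≤ x i) ∧ (∀ i, x i ≤ c i) ∧ s = fFP r v x T}
      = fLP r v c T ∧
    fFP r v ystar T = fLP r v c T := by
  have hv' : ∀ i, 0 ≤ v i := fun i => (hv i).le
  have hatt : fFP r v ystar T = fLP r v c T := by
    simp only [fFP, ZFP_of_feasibleLP hv' hfeas, hopt]
  refine ⟨IsGreatest.csSup_eq ⟨⟨ystar, hfeas.2.1, hfeas.2.2.2.1, hatt.symm⟩, ?_⟩, hatt⟩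
  rintro _ ⟨x, hx, hxc, rfl⟩
  exact le_fLP hr0 (feasibleLP_fluid hv' hx hxc hT)
end

section
/- For every number of customers T ∈ ℕ, every purchase probability p ∈ [0,1], and every inventory level c ∈ ℕ with c ≥ 1, the expected sales of a single product with uniform per-customer purchase probability p satisfies E[min(Bin(T,p), c)] ≥ (1 − 1/e)·min(T·p, c). -/
/-- Truncated binomial expectation `E[min(Bin(T,p), c)]`:
the expected sales of a product with `c` units in stock when each of `T` customers
independently buys one unit with probability `p` while stock remains. -/
noncomputable def binExpMin (T : ℕ) (p : ℝ) (c : ℝ) : ℝ :=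
  ∑ k ∈ Finset.range (T + 1),
    min (k : ℝ) c * ((T.choose k : ℝ) * p ^ k * (1 - p) ^ (T - k))

/-- Bernoulli's inequality truncated: `c * (1 - (1 - 1 / c) ^ k)` is a lower bound for
`min k c`. -/
theorem mul_one_sub_pow_le_min {c : ℝ} (hc : 1 ≤ c) (k : ℕ) :
    c * (1 - (1 - 1 / c) ^ k) ≤ min (k : ℝ) c := by
  have hc0 : 0 < c := by linarith
  have hinv : 1 / c ≤ 1 := (div_le_one hc0).2 hc
  have hpow : 0 ≤ (1 - 1 / c) ^ k := pow_nonneg (by linarith) k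
  have hbern := one_add_mul_le_pow (a := -(1 / c)) (by linarith) k
  rw [← sub_eq_add_neg] at hbern
  refine le_min ?_ (by nlinarith)
  calc c * (1 - (1 - 1 / c) ^ k) ≤ c * (k * (1 / c)) := by gcongr; linarith
    _ = k := by field_simp

/-- The probability generating function of the binomial distribution. -/
theorem sum_pow_mul_binomial (T : ℕ) (p q : ℝ) :
    ∑ k ∈ Finset.range (T + 1), q ^ k * ((T.choose k : ℝ) * p ^ k * (1 - p) ^ (T - k)) =
      (1 - p * (1 - q)) ^ T := by
  rw [show 1 - p * (1 - q) = q * p + (1 - p) by ring, add_pow]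
  exact Finset.sum_congr rfl fun k _ => by rw [mul_pow]; ring

theorem mul_one_sub_pow_le_binExpMin (T : ℕ) {p c : ℝ} (hp0 : 0 ≤ p) (hp1 : p ≤ 1)
    (hc : 1 ≤ c) : c * (1 - (1 - p / c) ^ T) ≤ binExpMin T p c := by
  have htotal := sum_pow_mul_binomial T p 1
  have hgen := sum_pow_mul_binomial T p (1 - 1 / c)
  simp only [one_pow, one_mul, sub_self, mul_zero, sub_zero] at htotal
  rw [show 1 - p * (1 - (1 - 1 / c)) = 1 - p / c by ring] at hgen
  calc c * (1 - (1 - p / c) ^ T)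
      = ∑ k ∈ Finset.range (T + 1), c * (1 - (1 - 1 / c) ^ k) *
          ((T.choose k : ℝ) * p ^ k * (1 - p) ^ (T - k)) := by
        simp only [mul_sub, sub_mul, mul_one, mul_assoc, Finset.sum_sub_distrib,
          ← Finset.mul_sum] at htotal hgen ⊢
        rw [hgen, htotal, mul_one]
    _ ≤ binExpMin T p c := by
        refine Finset.sum_le_sum fun k _ =>
          mul_le_mul_of_nonneg_right (mul_one_sub_pow_le_min hc k) ?_
        have : 0 ≤ 1 - p := by linarith
        positivity

theorem one_sub_exp_neg_one_mul_min_le {x : ℝ} (hx : 0 ≤ x) :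
    (1 - Real.exp (-1)) * min x 1 ≤ 1 - Real.exp (-x) := by
  rcases le_total x 1 with h | h
  · have hconv := convexOn_exp.2 (Set.mem_univ (-1)) (Set.mem_univ 0) hx
      (by linarith : 0 ≤ 1 - x) (by ring)
    simp only [smul_eq_mul, mul_zero, add_zero, mul_neg, mul_one, Real.exp_zero] at hconv
    rw [min_eq_left h]
    linarith
  · have := Real.exp_le_exp.2 (neg_le_neg h)
    rw [min_eq_right h]
    linarith

theorem stmt8 (T : ℕ) (p : ℝ) (hp0 : 0 ≤ p) (hp1 : p ≤ 1) (c : ℕ) (hc : 1 ≤ c) :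
    (1 - 1 / Real.exp 1) * min ((T : ℝ) * p) (c : ℝ) ≤ binExpMin T p (c : ℝ) := by
  have hc1 : (1 : ℝ) ≤ c := by exact_mod_cast hc
  have hc0 : (0 : ℝ) < c := by linarith
  have hpc : p / c ≤ 1 := (div_le_one hc0).2 (hp1.trans hc1)
  have hpow : (1 - p / c) ^ T ≤ Real.exp (-(T * p / c)) := by
    calc (1 - p / c) ^ T ≤ Real.exp (-(p / c)) ^ T :=
          pow_le_pow_left₀ (by linarith) (Real.one_sub_le_exp_neg _) T
      _ = Real.exp (-(T * p / c)) := by rw [← Real.exp_nat_mul]; ring_nf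
  have hmin : min ((T : ℝ) * p) c = c * min (T * p / c) 1 := by
    rw [mul_min_of_nonneg _ _ hc0.le, mul_div_cancel₀ _ hc0.ne', mul_one]
  calc (1 - 1 / Real.exp 1) * min ((T : ℝ) * p) c
      = c * ((1 - Real.exp (-1)) * min (T * p / c) 1) := by
        rw [hmin, Real.exp_neg, one_div]; ring
    _ ≤ c * (1 - Real.exp (-(T * p / c))) := by
        gcongr
        exact one_sub_exp_neg_one_mul_min_le (by positivity)
    _ ≤ c * (1 - (1 - p / c) ^ T) := by gcongr
    _ ≤ binExpMin T p c := mul_one_sub_pow_le_binExpMin T hp0 hp1 hc1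
end

section
/- Let T be a random variable with values in the nonnegative integers having the IFR property and finite mean μ_T, let p ∈ [0,1], and let c ∈ ℕ with c ≥ 1. Then E_T[ E[min(Bin(T,p), c)] ] ≥ (1/2)·min(p·μ_T, c). -/
/-- Tail probability `P(T ≥ k)` of a distribution on `ℕ` given by the pmf `q`. -/
noncomputable def tailP (q : ℕ → ℝ) (k : ℕ) : ℝ := ∑' j : ℕ, q (k + j)

/-- Increasing failure rate property: the hazard rate `k ↦ q k / P(T ≥ k)` is
nondecreasing (stated in cross-multiplied form). -/
def IFR (q : ℕ → ℝ) : Prop := ∀ k : ℕ, q k * tailP q (k + 1) ≤ q (k + 1) * tailP q k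

open Finset Filter Topology

/-- Expectation of `g` under the binomial distribution with `t` trials and success
probability `p`. -/
noncomputable def binE (p : ℝ) (t : ℕ) (g : ℕ → ℝ) : ℝ :=
  ∑ k ∈ range (t + 1), g k * ((t.choose k : ℝ) * p ^ k * (1 - p) ^ (t - k))

theorem binE_zero (p : ℝ) (g : ℕ → ℝ) : binE p 0 g = g 0 := by
  simp [binE]

/-- Conditioning on the last trial. -/
theorem binE_succ (p : ℝ) (t : ℕ) (g : ℕ → ℝ) :
    binE p (t + 1) g = (1 - p) * binE p t g + p * binE p t (fun k => g (k + 1)) := by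
  have hstep : ∀ k ∈ range (t + 1),
      g (k + 1) * (((t + 1).choose (k + 1) : ℝ) * p ^ (k + 1) * (1 - p) ^ (t + 1 - (k + 1)))
        = (1 - p) * (g (k + 1) * ((t.choose (k + 1) : ℝ) * p ^ (k + 1) * (1 - p) ^ (t - (k + 1))))
          + p * (g (k + 1) * ((t.choose k : ℝ) * p ^ k * (1 - p) ^ (t - k))) := by
    intro k hk
    rw [Nat.choose_succ_succ, Nat.add_sub_add_right]
    rcases Nat.lt_or_ge k t with h | h
    · obtain ⟨d, rfl⟩ : ∃ d, t = k + 1 + d := ⟨t - (k + 1), by omega⟩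
      have h1 : k + 1 + d - k = d + 1 := by omega
      have h2 : k + 1 + d - (k + 1) = d := by omega
      rw [h1, h2]
      push_cast
      ring
    · rw [Nat.choose_eq_zero_of_lt (show t < k + 1 by omega)]
      push_cast
      ring
  have hlow : binE p t g = ∑ k ∈ range (t + 1),
      g (k + 1) * ((t.choose (k + 1) : ℝ) * p ^ (k + 1) * (1 - p) ^ (t - (k + 1)))
        + g 0 * (1 - p) ^ t := by
    have := Finset.sum_range_succ'
      (fun k => g k * ((t.choose k : ℝ) * p ^ k * (1 - p) ^ (t - k))) (t + 1)
    rw [Finset.sum_range_succ] at this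
    simpa [binE] using this
  rw [hlow]
  unfold binE
  rw [Finset.sum_range_succ', Finset.sum_congr rfl hstep, Finset.sum_add_distrib,
    ← Finset.mul_sum, ← Finset.mul_sum]
  simp
  ring

theorem binE_mono {p : ℝ} (hp0 : 0 ≤ p) (hp1 : p ≤ 1) (t : ℕ) {g g' : ℕ → ℝ}
    (h : ∀ k, g k ≤ g' k) : binE p t g ≤ binE p t g' := by
  have : 0 ≤ 1 - p := by linarith
  exact Finset.sum_le_sum fun k _ => mul_le_mul_of_nonneg_right (h k) (by positivity)

theorem binE_add (p : ℝ) (t : ℕ) (g g' : ℕ → ℝ) :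
    binE p t (fun k => g k + g' k) = binE p t g + binE p t g' := by
  simp only [binE, add_mul, Finset.sum_add_distrib]

theorem binE_const_mul (p : ℝ) (t : ℕ) (a : ℝ) (g : ℕ → ℝ) :
    binE p t (fun k => a * g k) = a * binE p t g := by
  simp only [binE, mul_assoc, Finset.mul_sum]

theorem binE_const (p : ℝ) (t : ℕ) (a : ℝ) : binE p t (fun _ => a) = a := by
  induction t with
  | zero => exact binE_zero p _
  | succ t ih => rw [binE_succ, ih]; ring

/-- `P(Bin(t,p) ≥ c)`. -/
noncomputable def binTail (p : ℝ) (c t : ℕ) : ℝ := binE p t (fun k => if c ≤ k then 1 else 0)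

theorem binTail_nonneg {p : ℝ} (hp0 : 0 ≤ p) (hp1 : p ≤ 1) (c t : ℕ) : 0 ≤ binTail p c t := by
  rw [← binE_const p t 0]
  exact binE_mono hp0 hp1 t fun k => by split_ifs <;> norm_num

theorem binTail_le_one {p : ℝ} (hp0 : 0 ≤ p) (hp1 : p ≤ 1) (c t : ℕ) : binTail p c t ≤ 1 := by
  rw [← binE_const p t 1]
  exact binE_mono hp0 hp1 t fun k => by split_ifs <;> norm_num

theorem binTail_zero (p : ℝ) {c : ℕ} (hc : 1 ≤ c) : binTail p c 0 = 0 := by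
  rw [binTail, binE_zero, if_neg (by omega)]

theorem binTail_monotone {p : ℝ} (hp0 : 0 ≤ p) (hp1 : p ≤ 1) (c : ℕ) :
    Monotone (binTail p c) := by
  refine monotone_nat_of_le_succ fun t => ?_
  have h : binE p t (fun k => if c ≤ k then 1 else 0)
      ≤ binE p t (fun k => if c ≤ k + 1 then 1 else 0) :=
    binE_mono hp0 hp1 t fun k => by
      split_ifs <;> first | omega | norm_num
  unfold binTail
  rw [binE_succ]
  nlinarith

theorem binExpMin_zero (p : ℝ) (c : ℕ) : binExpMin 0 p c = 0 := by
  simp [binExpMin]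

theorem binExpMin_succ (p : ℝ) (c t : ℕ) :
    binExpMin (t + 1) p c = binExpMin t p c + p * (1 - binTail p c t) := by
  have h1 : ∀ t, binExpMin t p c = binE p t (fun k => min (k : ℝ) c) := fun _ => rfl
  have h2 : binE p t (fun k => min ((k + 1 : ℕ) : ℝ) c) + binTail p c t
      = binE p t (fun k => min (k : ℝ) c) + 1 := by
    rw [← binE_const p t 1, binTail, ← binE_add, ← binE_add]
    congr 1
    funext k
    split_ifs with h
    · rw [min_eq_right (by exact_mod_cast (by omega : c ≤ k + 1)),
        min_eq_right (by exact_mod_cast h)]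
    · rw [min_eq_left (by exact_mod_cast (by omega : k + 1 ≤ c)),
        min_eq_left (by exact_mod_cast (by omega : k ≤ c))]
      push_cast
      ring
  rw [h1, h1, binE_succ]
  linear_combination p * h2

theorem binExpMin_eq (p : ℝ) (c t : ℕ) :
    binExpMin t p c = p * (t : ℝ) - p * ∑ u ∈ range t, binTail p c u := by
  induction t with
  | zero => simp [binExpMin_zero]
  | succ t ih =>
    rw [binExpMin_succ, ih, Finset.sum_range_succ]
    push_cast
    ring

theorem mul_binTail_le_binExpMin {p : ℝ} (hp0 : 0 ≤ p) (hp1 : p ≤ 1) (c t : ℕ) :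
    (c : ℝ) * binTail p c t ≤ binExpMin t p c := by
  rw [binTail, ← binE_const_mul]
  refine binE_mono (g' := fun k => min (k : ℝ) c) hp0 hp1 t fun k => ?_
  split_ifs with h
  · rw [min_eq_right (by exact_mod_cast h), mul_one]
  · rw [mul_zero]; positivity

/-- Double summation of a sequence vanishing at `0`, in terms of its increments. -/
theorem sum_range_eq_sum_increments (a : ℕ → ℝ) (ha : a 0 = 0) (N : ℕ) :
    ∀ t ≤ N, ∑ u ∈ range t, a u
      = ∑ s ∈ range N, (a (s + 1) - a s) * ((t - (s + 1) : ℕ) : ℝ) := by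
  intro t
  induction t with
  | zero => simp
  | succ t ih =>
    intro ht
    have hsplit : ∀ s ∈ range N, (a (s + 1) - a s) * ((t + 1 - (s + 1) : ℕ) : ℝ)
        = (a (s + 1) - a s) * ((t - (s + 1) : ℕ) : ℝ)
          + if s < t then a (s + 1) - a s else 0 := by
      intro s _
      split_ifs with h
      · rw [show t + 1 - (s + 1) = t - (s + 1) + 1 by omega]
        push_cast
        ring
      · rw [show t + 1 - (s + 1) = 0 by omega, show t - (s + 1) = 0 by omega]
        simp
    have hfilter : (range N).filter (· < t) = range t := by
      ext s
      simp only [mem_filter, mem_range]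
      omega
    rw [Finset.sum_range_succ, ih (by omega), Finset.sum_congr rfl hsplit,
      Finset.sum_add_distrib, ← Finset.sum_filter, hfilter, Finset.sum_range_sub, ha, sub_zero]

section Tail

variable {q : ℕ → ℝ}

theorem tailP_nonneg (hq0 : ∀ k, 0 ≤ q k) (k : ℕ) : 0 ≤ tailP q k :=
  tsum_nonneg fun _ => hq0 _

theorem tailP_eq_add (hqs : Summable q) (k : ℕ) : tailP q k = q k + tailP q (k + 1) := by
  have hs : Summable fun j => q (k + j) := by
    simpa only [add_comm] using (summable_nat_add_iff k).2 hqs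
  rw [tailP, hs.tsum_eq_zero_add]
  simp only [tailP, add_zero, add_assoc, add_comm 1]

theorem tailP_antitone (hq0 : ∀ k, 0 ≤ q k) (hqs : Summable q) : Antitone (tailP q) :=
  antitone_nat_of_succ_le fun k => by linarith [tailP_eq_add hqs k, hq0 k]

theorem summable_ite_le (hq0 : ∀ k, 0 ≤ q k) (hqs : Summable q) (k : ℕ) :
    Summable fun t => if k ≤ t then q t else 0 :=
  hqs.of_nonneg_of_le (fun t => by split_ifs <;> simp [hq0])
    fun t => by split_ifs <;> simp [hq0]

theorem tailP_eq_tsum_ite (hq0 : ∀ k, 0 ≤ q k) (hqs : Summable q) (k : ℕ) :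
    tailP q k = ∑' t, if k ≤ t then q t else 0 := by
  rw [← (summable_ite_le hq0 hqs k).sum_add_tsum_nat_add k,
    Finset.sum_eq_zero fun t ht => if_neg (by simpa using ht), zero_add]
  simp [tailP, add_comm]

/-- Log-concavity of the tail of an IFR distribution, between `s` and `s + j`. -/
theorem IFR.tailP_mul_le (hIFR : IFR q) (hq0 : ∀ k, 0 ≤ q k) (hqs : Summable q) (s j : ℕ) :
    tailP q (s + j + 1) * tailP q s ≤ tailP q (s + j) * tailP q (s + 1) := by
  have hG := tailP_nonneg hq0
  have hA := tailP_antitone hq0 hqs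
  induction j with
  | zero => simp only [add_zero]; rw [mul_comm]
  | succ j ih =>
    have h1 := tailP_eq_add hqs (s + j)
    have h2 := tailP_eq_add hqs (s + j + 1)
    have h3 := hIFR (s + j)
    rw [← add_assoc]
    rcases (hG (s + j)).eq_or_lt with h0 | h0
    · have : tailP q (s + j + 1 + 1) = 0 :=
        le_antisymm (h0 ▸ hA (by omega)) (hG _)
      rw [this, zero_mul]
      exact mul_nonneg (hG _) (hG _)
    · have hlc : tailP q (s + j + 1 + 1) * tailP q (s + j)
          ≤ tailP q (s + j + 1) * tailP q (s + j + 1) := by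
        rw [eq_sub_of_add_eq h1.symm, eq_sub_of_add_eq h2.symm] at h3
        linarith
      refine le_of_mul_le_mul_right ?_ h0
      nlinarith [mul_le_mul_of_nonneg_right hlc (hG s),
        mul_le_mul_of_nonneg_left ih (hG (s + j + 1))]

/-- An IFR distribution is new better than used. -/
theorem IFR.tailP_add_le (hIFR : IFR q) (hq0 : ∀ k, 0 ≤ q k) (hqs : Summable q)
    (hq1 : ∑' k, q k = 1) (s j : ℕ) : tailP q (s + j) ≤ tailP q s * tailP q j := by
  have hG := tailP_nonneg hq0
  have hA := tailP_antitone hq0 hqs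
  induction s with
  | zero => simp [tailP, hq1]
  | succ s ih =>
    rw [show s + 1 + j = s + j + 1 by omega]
    rcases (hG s).eq_or_lt with h0 | h0
    · exact (h0 ▸ hA (by omega) : tailP q (s + j + 1) ≤ 0).trans (mul_nonneg (hG _) (hG _))
    · refine le_of_mul_le_mul_right ?_ h0
      nlinarith [hIFR.tailP_mul_le hq0 hqs s j, mul_le_mul_of_nonneg_right ih (hG (s + 1))]

theorem summable_mul_tsub (hq0 : ∀ k, 0 ≤ q k) (hms : Summable fun k : ℕ => (k : ℝ) * q k)
    (s : ℕ) : Summable fun t : ℕ => q t * ((t - s : ℕ) : ℝ) :=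
  hms.of_nonneg_of_le (fun t => mul_nonneg (hq0 t) (Nat.cast_nonneg _)) fun t => by
    rw [mul_comm]
    exact mul_le_mul_of_nonneg_right (by exact_mod_cast Nat.sub_le t s) (hq0 t)

/-- The expected excess `E[(T - s)⁺]` as a sum of tail probabilities plus a remainder. -/
theorem tsum_mul_tsub_eq (hq0 : ∀ k, 0 ≤ q k) (hqs : Summable q)
    (hms : Summable fun k : ℕ => (k : ℝ) * q k) (s n : ℕ) :
    ∑' t : ℕ, q t * ((t - s : ℕ) : ℝ)
      = ∑ j ∈ range n, tailP q (s + j + 1) + ∑' t : ℕ, q t * ((t - (s + n) : ℕ) : ℝ) := by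
  induction n with
  | zero => simp
  | succ n ih =>
    rw [ih, Finset.sum_range_succ, add_assoc, tailP_eq_tsum_ite hq0 hqs,
      ← (summable_ite_le hq0 hqs _).tsum_add (summable_mul_tsub hq0 hms _)]
    congr 2
    funext t
    split_ifs with h
    · rw [show t - (s + n) = t - (s + (n + 1)) + 1 by omega]
      push_cast
      ring
    · rw [show t - (s + n) = 0 by omega, show t - (s + (n + 1)) = 0 by omega]
      simp

theorem tendsto_tsum_mul_tsub (hq0 : ∀ k, 0 ≤ q k)
    (hms : Summable fun k : ℕ => (k : ℝ) * q k) :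
    Tendsto (fun n => ∑' t : ℕ, q t * ((t - n : ℕ) : ℝ)) atTop (𝓝 0) := by
  refine squeeze_zero (fun n => tsum_nonneg fun t => mul_nonneg (hq0 t) (Nat.cast_nonneg _))
    (fun n => ?_) (tendsto_sum_nat_add fun k : ℕ => (k : ℝ) * q k)
  rw [← (summable_mul_tsub hq0 hms n).sum_add_tsum_nat_add n,
    Finset.sum_eq_zero fun t ht => by
      rw [show t - n = 0 by have := Finset.mem_range.1 ht; omega]; simp, zero_add]
  refine Summable.tsum_le_tsum (fun k => ?_)
    ((summable_nat_add_iff n).2 (summable_mul_tsub hq0 hms n)) ((summable_nat_add_iff n).2 hms)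
  rw [mul_comm]
  exact mul_le_mul_of_nonneg_right (by exact_mod_cast Nat.sub_le (k + n) n) (hq0 _)

/-- An IFR distribution is new better than used in expectation. -/
theorem IFR.tsum_mul_tsub_le (hIFR : IFR q) (hq0 : ∀ k, 0 ≤ q k) (hqs : Summable q)
    (hq1 : ∑' k, q k = 1) (hms : Summable fun k : ℕ => (k : ℝ) * q k) (s : ℕ) :
    ∑' t : ℕ, q t * ((t - s : ℕ) : ℝ) ≤ tailP q s * ∑' k : ℕ, (k : ℝ) * q k := by
  have hlim : Tendsto (fun n => tailP q s * ∑' k : ℕ, (k : ℝ) * q k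
      + ∑' t : ℕ, q t * ((t - (s + n) : ℕ) : ℝ)) atTop
      (𝓝 (tailP q s * ∑' k : ℕ, (k : ℝ) * q k + 0)) :=
    ((tendsto_tsum_mul_tsub hq0 hms).comp
      (tendsto_atTop_mono (fun n => Nat.le_add_left n s) tendsto_id)).const_add _
  rw [add_zero] at hlim
  refine ge_of_tendsto' hlim fun n => ?_
  have hmean : ∑ j ∈ range n, tailP q (j + 1) ≤ ∑' k : ℕ, (k : ℝ) * q k := by
    have h := tsum_mul_tsub_eq hq0 hqs hms 0 n
    have h0 : 0 ≤ ∑' t : ℕ, q t * ((t - (0 + n) : ℕ) : ℝ) :=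
      tsum_nonneg fun t => mul_nonneg (hq0 t) (Nat.cast_nonneg _)
    simp only [zero_add, Nat.sub_zero, mul_comm (q _)] at h h0
    linarith
  rw [tsum_mul_tsub_eq hq0 hqs hms s n]
  gcongr
  calc ∑ j ∈ range n, tailP q (s + j + 1)
      ≤ ∑ j ∈ range n, tailP q s * tailP q (j + 1) :=
        Finset.sum_le_sum fun j _ => hIFR.tailP_add_le hq0 hqs hq1 s (j + 1)
    _ ≤ _ := by
        rw [← Finset.mul_sum]
        exact mul_le_mul_of_nonneg_left hmean (tailP_nonneg hq0 s)

theorem summable_mul_of_le_one (hq0 : ∀ k, 0 ≤ q k) (hqs : Summable q) {a : ℕ → ℝ}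
    (ha0 : ∀ t, 0 ≤ a t) (ha1 : ∀ t, a t ≤ 1) : Summable fun t => q t * a t :=
  hqs.of_nonneg_of_le (fun t => mul_nonneg (hq0 t) (ha0 t))
    fun t => mul_le_of_le_one_right (hq0 t) (ha1 t)

/-- For `T` distributed as `q` and `a` the distribution function of an independent positive
time `S`, the bound `E[(T - S)⁺] ≤ P(S ≤ T) * E[T]`. -/
theorem IFR.tsum_mul_sum_range_le (hIFR : IFR q) (hq0 : ∀ k, 0 ≤ q k) (hqs : Summable q)
    (hq1 : ∑' k, q k = 1) (hms : Summable fun k : ℕ => (k : ℝ) * q k)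
    {a : ℕ → ℝ} (ha : Monotone a) (ha0 : a 0 = 0) (ha1 : ∀ t, a t ≤ 1) :
    ∑' t, q t * ∑ u ∈ range t, a u ≤ (∑' t, q t * a t) * ∑' k : ℕ, (k : ℝ) * q k := by
  have hnn : ∀ t, 0 ≤ a t := fun t => ha0 ▸ ha (Nat.zero_le t)
  have hw : ∀ s, 0 ≤ a (s + 1) - a s := fun s => sub_nonneg.2 (ha (Nat.le_succ s))
  have hμ : 0 ≤ ∑' k : ℕ, (k : ℝ) * q k :=
    tsum_nonneg fun k => mul_nonneg (Nat.cast_nonneg k) (hq0 k)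
  refine Real.tsum_le_of_sum_range_le
    (fun t => mul_nonneg (hq0 t) (Finset.sum_nonneg fun u _ => hnn u)) fun N => ?_
  have htail : ∑ s ∈ range N, (a (s + 1) - a s) * tailP q (s + 1) ≤ ∑' t, q t * a t := by
    have hsum : ∀ s ∈ range N,
        Summable fun t => (a (s + 1) - a s) * if s + 1 ≤ t then q t else 0 :=
      fun s _ => (summable_ite_le hq0 hqs (s + 1)).mul_left _
    simp_rw [tailP_eq_tsum_ite hq0 hqs, ← tsum_mul_left]
    rw [← Summable.tsum_finsetSum hsum]
    refine Summable.tsum_le_tsum (fun t => ?_) (summable_sum hsum)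
      (summable_mul_of_le_one hq0 hqs hnn ha1)
    calc ∑ s ∈ range N, (a (s + 1) - a s) * (if s + 1 ≤ t then q t else 0)
        = q t * ∑ s ∈ (range N).filter (· + 1 ≤ t), (a (s + 1) - a s) := by
          rw [Finset.sum_filter, Finset.mul_sum]
          refine Finset.sum_congr rfl fun s _ => ?_
          split_ifs <;> ring
      _ ≤ q t * ∑ s ∈ range t, (a (s + 1) - a s) := by
          refine mul_le_mul_of_nonneg_left (Finset.sum_le_sum_of_subset_of_nonneg
            (fun s hs => ?_) fun s _ _ => hw s) (hq0 t)
          simp only [mem_filter, mem_range] at hs ⊢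
          omega
      _ = q t * a t := by rw [Finset.sum_range_sub, ha0, sub_zero]
  calc ∑ t ∈ range N, q t * ∑ u ∈ range t, a u
      = ∑ t ∈ range N, ∑ s ∈ range N,
          (a (s + 1) - a s) * (q t * ((t - (s + 1) : ℕ) : ℝ)) := by
        refine Finset.sum_congr rfl fun t ht => ?_
        rw [sum_range_eq_sum_increments a ha0 N t (Finset.mem_range.1 ht).le, Finset.mul_sum]
        exact Finset.sum_congr rfl fun s _ => by ring
    _ = ∑ s ∈ range N, (a (s + 1) - a s) * ∑ t ∈ range N, q t * ((t - (s + 1) : ℕ) : ℝ) := by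
        rw [Finset.sum_comm]
        simp_rw [Finset.mul_sum]
    _ ≤ ∑ s ∈ range N, (a (s + 1) - a s) * (tailP q (s + 1) * ∑' k : ℕ, (k : ℝ) * q k) :=
        Finset.sum_le_sum fun s _ => mul_le_mul_of_nonneg_left
          (((summable_mul_tsub hq0 hms (s + 1)).sum_le_tsum _
            fun t _ => mul_nonneg (hq0 t) (Nat.cast_nonneg _)).trans
              (hIFR.tsum_mul_tsub_le hq0 hqs hq1 hms (s + 1))) (hw s)
    _ = (∑ s ∈ range N, (a (s + 1) - a s) * tailP q (s + 1)) * ∑' k : ℕ, (k : ℝ) * q k := by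
        rw [Finset.sum_mul]
        exact Finset.sum_congr rfl fun s _ => by ring
    _ ≤ _ := mul_le_mul_of_nonneg_right htail hμ

end Tail

theorem stmt9 (q : ℕ → ℝ) (hq0 : ∀ k, 0 ≤ q k) (hqs : Summable q)
    (hq1 : ∑' k, q k = 1) (hIFR : IFR q)
    (μ : ℝ) (hms : Summable (fun k : ℕ => (k : ℝ) * q k))
    (hμ : μ = ∑' k : ℕ, (k : ℝ) * q k)
    (p : ℝ) (hp0 : 0 ≤ p) (hp1 : p ≤ 1) (c : ℕ) (hc : 1 ≤ c) :
    (1 / 2) * min (p * μ) (c : ℝ) ≤ ∑' k : ℕ, q k * binExpMin k p (c : ℝ) := by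
  have hA0 := binTail_nonneg hp0 hp1 c
  have hA1 := binTail_le_one hp0 hp1 c
  have hsA : Summable fun t => q t * binTail p c t := summable_mul_of_le_one hq0 hqs hA0 hA1
  have hsD : Summable fun t => q t * ∑ u ∈ range t, binTail p c u := by
    refine hms.of_nonneg_of_le
      (fun t => mul_nonneg (hq0 t) (Finset.sum_nonneg fun u _ => hA0 u)) fun t => ?_
    rw [mul_comm]
    refine mul_le_mul_of_nonneg_right ?_ (hq0 t)
    simpa using Finset.sum_le_card_nsmul (range t) (binTail p c) 1 fun u _ => hA1 u
  have hexp : ∀ t : ℕ, q t * binExpMin t p c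
      = p * ((t : ℝ) * q t) - p * (q t * ∑ u ∈ range t, binTail p c u) := fun t => by
    rw [binExpMin_eq]
    ring
  have hsF : Summable fun t => q t * binExpMin t p c := by
    simpa only [hexp] using (hms.mul_left p).sub (hsD.mul_left p)
  have hF : ∑' t, q t * binExpMin t p c
      = p * μ - p * ∑' t, q t * ∑ u ∈ range t, binTail p c u := by
    simp_rw [hexp]
    rw [(hms.mul_left p).tsum_sub (hsD.mul_left p), tsum_mul_left, tsum_mul_left, hμ]
  have hD := hIFR.tsum_mul_sum_range_le hq0 hqs hq1 hms (binTail_monotone hp0 hp1 c)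
    (binTail_zero p hc) hA1
  rw [← hμ] at hD
  have hch : (c : ℝ) * ∑' t, q t * binTail p c t ≤ ∑' t, q t * binExpMin t p c := by
    rw [← tsum_mul_left]
    refine Summable.tsum_le_tsum (fun t => ?_) (hsA.mul_left _) hsF
    rw [mul_left_comm]
    exact mul_le_mul_of_nonneg_left (mul_binTail_le_binExpMin hp0 hp1 c t) (hq0 t)
  have hμ0 : 0 ≤ p * μ := mul_nonneg hp0 <| hμ ▸
    tsum_nonneg fun k => mul_nonneg (Nat.cast_nonneg k) (hq0 k)
  have hpD := mul_le_mul_of_nonneg_left hD hp0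
  have hc0 : (0 : ℝ) ≤ c := Nat.cast_nonneg c
  rcases le_total (1 / 2) (∑' t, q t * binTail p c t) with h | h
  · nlinarith [min_le_right (p * μ) (c : ℝ)]
  · nlinarith [min_le_left (p * μ) (c : ℝ)]
end

section
/- Let p ∈ (0,1) and let T be geometrically distributed on {1,2,3,…} with P(T = k) = p(1−p)^{k−1}, so that E[T] = 1/p and p·E[T] = 1. Then E_T[1 − (1−p)^T] = 1/(2−p). Consequently, since E[min(Bin(T,p),1)] = 1 − (1−p)^T, the ratio E_T[E[min(Bin(T,p),1)]]/min(p·E[T], 1) = 1/(2−p) tends to 1/2 as p → 0+; hence the constant 1/2 in the IFR bound E_T[E[min(Bin(T,p),c)]] ≥ (1/2)·min(p·E[T], c) is tight. -/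
/-- A binomial count truncated at one is the indicator that the count is positive. -/
theorem binExpMin_one (T : ℕ) (p : ℝ) : binExpMin T p 1 = 1 - (1 - p) ^ T := by
  have htotal : ∑ k ∈ Finset.range (T + 1),
      (T.choose k : ℝ) * p ^ k * (1 - p) ^ (T - k) = 1 := by
    have h := add_pow p (1 - p) T
    rw [add_sub_cancel, one_pow] at h
    exact (Finset.sum_congr rfl fun k _ => by ring).trans h.symm
  rw [Finset.sum_range_succ'] at htotal
  have hmin (k : ℕ) : min ((k + 1 : ℕ) : ℝ) 1 = 1 :=
    min_eq_right (by exact_mod_cast Nat.le_add_left 1 k)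
  rw [binExpMin, Finset.sum_range_succ']
  simp only [hmin, one_mul]
  simp at htotal ⊢
  linarith

/-- The mean of the geometric distribution on the positive integers. -/
theorem hasSum_coe_mul_geometric_pmf {p : ℝ} (hp0 : 0 < p) (hp1 : p < 1) :
    HasSum (fun k : ℕ => (k : ℝ) * if k = 0 then 0 else p * (1 - p) ^ (k - 1)) (1 / p) := by
  have hr : 1 - p ≠ 0 := by linarith
  have h := (hasSum_coe_mul_geometric_of_norm_lt_one (r := 1 - p)
    (by rw [Real.norm_eq_abs, abs_lt]; constructor <;> linarith)).mul_left (p / (1 - p))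
  have hval : p / (1 - p) * ((1 - p) / (1 - (1 - p)) ^ 2) = 1 / p := by
    rw [sub_sub_cancel]
    field_simp
  rw [hval] at h
  refine h.congr_fun fun k => ?_
  rcases k with _ | k
  · simp
  · simp only [Nat.add_one_ne_zero, if_false, Nat.add_sub_cancel, pow_succ]
    field_simp

/-- The probability of at least one success in a geometric number of independent trials. -/
theorem hasSum_geometric_pmf_mul_one_sub_pow {p : ℝ} (hp0 : 0 < p) (hp1 : p < 1) :
    HasSum (fun k : ℕ => (if k = 0 then 0 else p * (1 - p) ^ (k - 1)) * (1 - (1 - p) ^ k))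
      (1 / (2 - p)) := by
  have hr : 1 - p ≠ 0 := by linarith
  have h2 : 2 - p ≠ 0 := by linarith
  have hgeom := hasSum_geometric_of_lt_one (r := 1 - p) (by linarith) (by linarith)
  have hgeom_sq := hasSum_geometric_of_lt_one (r := (1 - p) ^ 2) (by positivity) (by nlinarith)
  have h := (hgeom.sub hgeom_sq).mul_left (p / (1 - p))
  have hval : p / (1 - p) * ((1 - (1 - p))⁻¹ - (1 - (1 - p) ^ 2)⁻¹) = 1 / (2 - p) := by
    rw [sub_sub_cancel, show 1 - (1 - p) ^ 2 = p * (2 - p) by ring]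
    field_simp
    ring
  rw [hval] at h
  refine h.congr_fun fun k => ?_
  rcases k with _ | k
  · simp
  · simp only [Nat.add_one_ne_zero, if_false, Nat.add_sub_cancel, ← pow_mul]
    field_simp
    ring

theorem stmt10 (p : ℝ) (hp0 : 0 < p) (hp1 : p < 1) (q : ℕ → ℝ)
    (hq : ∀ k : ℕ, q k = if k = 0 then 0 else p * (1 - p) ^ (k - 1)) :
    (∑' k : ℕ, (k : ℝ) * q k = 1 / p) ∧
    (∀ T : ℕ, binExpMin T p 1 = 1 - (1 - p) ^ T) ∧
    (∑' k : ℕ, q k * (1 - (1 - p) ^ k) = 1 / (2 - p)) ∧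
    Filter.Tendsto (fun s : ℝ => 1 / (2 - s)) (nhdsWithin 0 (Set.Ioi 0))
      (nhds (1 / 2)) := by
  obtain rfl : q = fun k => if k = 0 then 0 else p * (1 - p) ^ (k - 1) := funext hq
  refine ⟨(hasSum_coe_mul_geometric_pmf hp0 hp1).tsum_eq, fun T => binExpMin_one T p,
    (hasSum_geometric_pmf_mul_one_sub_pow hp0 hp1).tsum_eq, ?_⟩
  have h : ContinuousAt (fun s : ℝ => 1 / (2 - s)) 0 :=
    continuousAt_const.div (by fun_prop) (by norm_num)
  simpa using h.tendsto.mono_left nhdsWithin_le_nhds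
end

section
/- Let x, w ∈ ℤ_{≥0}^n with w_j ≤ x_j for all j, let i ∈ {1,…,n} with w_i = 0, and let T ∈ ℕ with T ≥ Σ_{j=1}^n w_j. Then the expected consumption in the stochastic consumption process satisfies Z_i(x, T) ≥ Z_i(x − w, T − Σ_{j=1}^n w_j). -/
open Finset

/-- Expected consumption `Z_i(x,T)` of product `i` in the stochastic consumption
process without personalization under MNL, defined recursively over the number
of customers `T`.  `N(x) = {k : x_k ≥ 1}` is the set of available products and
`φ(j,S) = v_j / (1 + ∑_{k∈S} v_k)` (outside option weight `1`). -/
noncomputable def Zstoch {n : ℕ} (v : Fin n → ℝ) (i : Fin n) : ℕ → (Fin n → ℕ) → ℝ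
  | 0, _ => 0
  | T + 1, x =>
    (∑ j ∈ Finset.univ.filter (fun k => 1 ≤ x k),
      v j / (1 + ∑ k ∈ Finset.univ.filter (fun k => 1 ≤ x k), v k) *
        ((if j = i then 1 else 0) +
          Zstoch v i T (fun k => if k = j then x k - 1 else x k))) +
    (1 / (1 + ∑ k ∈ Finset.univ.filter (fun k => 1 ≤ x k), v k)) * Zstoch v i T x

theorem Zstoch_nonneg {n : ℕ} (v : Fin n → ℝ) (hv : ∀ j, 0 < v j) (i : Fin n)
    (T : ℕ) (x : Fin n → ℕ) : 0 ≤ Zstoch v i T x := by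
  induction T generalizing x with
  | zero => simp [Zstoch]
  | succ T ih =>
    have hV : 0 ≤ ∑ k ∈ univ.filter (fun k => 1 ≤ x k), v k :=
      sum_nonneg fun k _ => (hv k).le
    rw [Zstoch]
    refine add_nonneg (sum_nonneg fun j _ => mul_nonneg ?_ (add_nonneg ?_ (ih _)))
      (mul_nonneg (by positivity) (ih _))
    · exact div_nonneg (hv j).le (by positivity)
    · split_ifs <;> norm_num

/-- The recursion for `Zstoch` with the common denominator cleared. -/
theorem total_weight_mul_Zstoch_succ {n : ℕ} (v : Fin n → ℝ) (hv : ∀ j, 0 < v j) (i : Fin n)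
    (T : ℕ) (x : Fin n → ℕ) :
    (1 + ∑ k ∈ univ.filter (fun k => 1 ≤ x k), v k) * Zstoch v i (T + 1) x =
      (∑ j ∈ univ.filter (fun k => 1 ≤ x k), v j * ((if j = i then 1 else 0) +
        Zstoch v i T (fun k => if k = j then x k - 1 else x k))) + Zstoch v i T x := by
  have hV : 0 ≤ ∑ k ∈ univ.filter (fun k => 1 ≤ x k), v k :=
    sum_nonneg fun k _ => (hv k).le
  have ha : (1 + ∑ k ∈ univ.filter (fun k => 1 ≤ x k), v k) ≠ 0 := by positivity
  rw [Zstoch, mul_add, mul_sum, ← mul_assoc, mul_one_div_cancel ha, one_mul]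
  congr 1
  refine sum_congr rfl fun j _ => ?_
  rw [← mul_assoc, mul_div_cancel₀ _ ha]

/-- Adding units of products other than `i`, together with as many customers, does not decrease
the expected consumption of `i`. -/
theorem Zstoch_le_Zstoch_add {n : ℕ} (v : Fin n → ℝ) (hv : ∀ j, 0 < v j) {i : Fin n}
    {w : Fin n → ℕ} (hwi : w i = 0) (T t : ℕ) (y : Fin n → ℕ) (hT : T = t + ∑ j, w j) :
    Zstoch v i t y ≤ Zstoch v i T (fun j => y j + w j) := by
  induction T generalizing t y w with
  | zero =>
    obtain rfl : t = 0 := by omega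
    simp [Zstoch]
  | succ T ih =>
    obtain _ | t := t
    · exact Zstoch_nonneg v hv i _ _
    have hV : 0 ≤ ∑ k ∈ univ.filter (fun k => 1 ≤ y k + w k), v k :=
      sum_nonneg fun k _ => (hv k).le
    have hsub : univ.filter (fun k => 1 ≤ y k) ⊆ univ.filter (fun k => 1 ≤ y k + w k) :=
      monotone_filter_right _ fun k _ (hk : 1 ≤ y k) => le_add_right hk
    have hstay : ∀ j ∈ univ.filter (fun k => 1 ≤ y k),
        v j * ((if j = i then 1 else 0) +
          Zstoch v i t (fun k => if k = j then y k - 1 else y k)) ≤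
        v j * ((if j = i then 1 else 0) +
          Zstoch v i T (fun k => if k = j then y k + w k - 1 else y k + w k)) := by
      intro j hj
      have hj : 1 ≤ y j := (mem_filter.mp hj).2
      have h := ih hwi t (fun k => if k = j then y k - 1 else y k) (by omega)
      have he : (fun k => (if k = j then y k - 1 else y k) + w k) =
          fun k => if k = j then y k + w k - 1 else y k + w k := by
        funext k
        split_ifs with hk
        · subst hk; omega
        · rfl
      rw [he] at h
      exact mul_le_mul_of_nonneg_left (by gcongr) (hv j).le
    have hextra : ∀ j ∈ univ.filter (fun k => 1 ≤ y k + w k) \ univ.filter (fun k => 1 ≤ y k),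
        v j * Zstoch v i (t + 1) y ≤
        v j * ((if j = i then 1 else 0) +
          Zstoch v i T (fun k => if k = j then y k + w k - 1 else y k + w k)) := by
      intro j hj
      simp only [mem_sdiff, mem_filter, mem_univ, true_and] at hj
      have hji : j ≠ i := by rintro rfl; omega
      have hsum : ∑ k, w k = ∑ k, (if k = j then w k - 1 else w k) + 1 := by
        have hone : ∑ k, (if k = j then 1 else 0) = 1 := Fintype.sum_ite_eq' j (fun _ => 1)
        rw [← add_left_cancel_iff.mpr hone, ← sum_add_distrib]
        refine sum_congr rfl fun k _ => ?_
        split_ifs with hk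
        · subst hk; omega
        · rfl
      have h := ih (w := fun k => if k = j then w k - 1 else w k)
        (by simp [hji.symm, hwi]) (t + 1) y (by omega)
      have he : (fun k => y k + (if k = j then w k - 1 else w k)) =
          fun k => if k = j then y k + w k - 1 else y k + w k := by
        funext k
        split_ifs with hk
        · subst hk; omega
        · rfl
      rw [he] at h
      rw [if_neg hji, zero_add]
      exact mul_le_mul_of_nonneg_left h (hv j).le
    refine le_of_mul_le_mul_left ?_
      (show 0 < 1 + ∑ k ∈ univ.filter (fun k => 1 ≤ y k + w k), v k by positivity)
    rw [total_weight_mul_Zstoch_succ v hv i T, ← sum_sdiff hsub, ← sum_sdiff hsub]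
    have hy := total_weight_mul_Zstoch_succ v hv i t y
    have h₁ := sum_le_sum hstay
    have h₂ := sum_le_sum hextra
    rw [← sum_mul] at h₂
    have h₃ := ih hwi t y (by omega)
    linarith

theorem stmt12 {n : ℕ} (hn : 1 ≤ n) (r v : Fin n → ℝ)
    (hr : ∀ i j : Fin n, i ≤ j → r j ≤ r i) (hr0 : ∀ i, 0 ≤ r i)
    (hv : ∀ i, 0 < v i)
    (x w : Fin n → ℕ) (hw : ∀ j, w j ≤ x j)
    (i : Fin n) (hwi : w i = 0)
    (T : ℕ) (hT : (∑ j, w j) ≤ T) :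
    Zstoch v i (T - ∑ j, w j) (fun j => x j - w j) ≤ Zstoch v i T x := by
  have h := Zstoch_le_Zstoch_add v hv hwi T (T - ∑ j, w j) (fun j => x j - w j) (by omega)
  have hx : (fun j => x j - w j + w j) = x := funext fun j => Nat.sub_add_cancel (hw j)
  rwa [hx] at h
end

section
/- (Factor-revealing inequality for rounding the fractional item.) Let T ≥ 1 and let real numbers a, b, d, r, η, γ satisfy 0 ≤ η ≤ γ ≤ 1, 0 ≤ d ≤ r ≤ a, r ≤ b, and r > 0. Then max( (T−γ)·a + γ·r , (T−γ)·a + (γ−η)·b + η·d ) ≥ (T/(T+1))·( (T−γ)·a + (γ−η)·b + η·r ). Equivalently, rounding the single fractional unit up or down loses at most a 1/(T+1) fraction of the fluid revenue, since (T−γ)a + (γ−η)b + ηr represents f^FP(x^c,T), (T−γ)a + γr represents the round-up value, and (T−γ)a + (γ−η)b + ηd the round-down value. -/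
theorem stmt18 (T a b d r η γ : ℝ) (hT : 1 ≤ T)
    (hη0 : 0 ≤ η) (hηγ : η ≤ γ) (hγ1 : γ ≤ 1)
    (hd0 : 0 ≤ d) (hdr : d ≤ r) (hra : r ≤ a) (hrb : r ≤ b) (hr : 0 < r) :
    T / (T + 1) * ((T - γ) * a + (γ - η) * b + η * r) ≤
      max ((T - γ) * a + γ * r) ((T - γ) * a + (γ - η) * b + η * d) := by
  have hT1 : 0 < T + 1 := by linarith
  have hηd : 0 ≤ η * d := mul_nonneg hη0 hd0
  have hA : (T - γ) * r ≤ (T - γ) * a := mul_le_mul_of_nonneg_left hra (by linarith)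
  have hηr : T * (η * r) ≤ T * r :=
    mul_le_mul_of_nonneg_left (mul_le_of_le_one_left hr.le (by linarith)) (by linarith)
  rw [div_mul_eq_mul_div, le_max_iff, div_le_iff₀ hT1, div_le_iff₀ hT1]
  generalize (T - γ) * a = A at *
  generalize (γ - η) * b = B at *
  rcases le_total (A + B) (T * (η * r)) with h | h
  · left
    have h₁ : T * (A + B) ≤ T * (T * (η * r)) := mul_le_mul_of_nonneg_left h (by linarith)
    have h₂ : 0 ≤ (T + 1) * (A + γ * r - T * (η * r)) :=
      mul_nonneg hT1.le (by linarith)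
    linarith
  · right
    have h₁ : 0 ≤ (T + 1) * (η * d) := mul_nonneg hT1.le hηd
    linarith
end

section
/- For every integer x ≥ 1 and every real y with 0 < y ≤ 1, one has (1 − 1/(x+y))^x ≥ y/e, i.e., ((x+y−1)/(x+y))^x / y ≥ 1/e. Moreover, the infimum of ((x+y−1)/(x+y))^x / y over all integers x ≥ 1 and reals y ∈ (0,1] equals 1/e (it is approached as y = 1 and x → ∞ but is not attained). -/
/-- The inequality `(1 + 1 / n) ^ n < e`, written for the reciprocal. -/
theorem inv_exp_one_lt_div_add_one_pow {n : ℕ} (hn : 1 ≤ n) :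
    (Real.exp 1)⁻¹ < ((n : ℝ) / (n + 1)) ^ n := by
  have hpos : (0 : ℝ) < n := by exact_mod_cast hn
  have hlt : (1 / (n : ℝ) + 1) ^ n < Real.exp 1 := by
    calc (1 / (n : ℝ) + 1) ^ n < Real.exp (1 / n) ^ n :=
          pow_lt_pow_left₀ (Real.add_one_lt_exp (by positivity)) (by positivity) (by lia)
      _ = Real.exp 1 := by rw [← Real.exp_nat_mul, mul_one_div_cancel hpos.ne']
  have heq : (n : ℝ) / (n + 1) = (1 / (n : ℝ) + 1)⁻¹ := by field_simp; ring
  rw [heq, inv_pow]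
  exact inv_strictAnti₀ (by positivity) hlt

/-- By Bernoulli's inequality, the ratio `(1 - 1 / (n + y)) ^ n / y` is smallest at `y = 1`. -/
theorem mul_div_add_one_pow_le_one_sub_pow {n : ℕ} {y : ℝ} (hn : 1 ≤ n) (hy : 0 < y)
    (hy1 : y ≤ 1) : y * ((n : ℝ) / (n + 1)) ^ n ≤ (1 - 1 / ((n : ℝ) + y)) ^ n := by
  have hn1 : (1 : ℝ) ≤ n := by exact_mod_cast hn
  have hpos : (0 : ℝ) < n := by linarith
  have hfactor : 1 - 1 / ((n : ℝ) + y) =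
      (1 + -((1 - y) / (n * (n + y)))) * ((n : ℝ) / (n + 1)) := by
    field_simp
    ring
  have hle : (1 - y) / (n * (n + y)) ≤ 1 := by
    rw [div_le_one (by positivity)]
    nlinarith
  have hbern : y ≤ (1 + -((1 - y) / (n * (n + y)))) ^ n := by
    refine le_trans ?_ (one_add_mul_le_pow (by linarith) n)
    have hcancel : (n : ℝ) * -((1 - y) / (n * (n + y))) = -((1 - y) / (n + y)) := by
      field_simp
    have hdiv : (1 - y) / (n + y) ≤ 1 - y := div_le_self (by linarith) (by linarith)
    rw [hcancel]
    linarith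
  rw [hfactor, mul_pow]
  gcongr

theorem div_exp_one_lt_one_sub_pow {n : ℕ} {y : ℝ} (hn : 1 ≤ n) (hy : 0 < y) (hy1 : y ≤ 1) :
    y / Real.exp 1 < (1 - 1 / ((n : ℝ) + y)) ^ n := by
  rw [div_eq_mul_inv]
  exact (mul_lt_mul_of_pos_left (inv_exp_one_lt_div_add_one_pow hn) hy).trans_le
    (mul_div_add_one_pow_le_one_sub_pow hn hy hy1)

theorem one_div_exp_one_lt_one_sub_pow_div {n : ℕ} {y : ℝ} (hn : 1 ≤ n) (hy : 0 < y)
    (hy1 : y ≤ 1) : 1 / Real.exp 1 < (1 - 1 / ((n : ℝ) + y)) ^ n / y := by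
  rw [lt_div_iff₀ hy, one_div_mul_eq_div]
  exact div_exp_one_lt_one_sub_pow hn hy hy1

theorem tendsto_one_sub_one_div_add_one_pow :
    Filter.Tendsto (fun n : ℕ => (1 - 1 / ((n : ℝ) + 1)) ^ n) Filter.atTop
      (nhds (1 / Real.exp 1)) := by
  rw [one_div]
  refine ((Real.tendsto_one_add_div_pow_exp 1).inv₀ (Real.exp_ne_zero 1)).congr' ?_
  filter_upwards [Filter.eventually_ge_atTop 1] with n hn
  have hpos : (0 : ℝ) < n := by exact_mod_cast hn
  rw [← inv_pow]
  congr 1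
  field_simp
  ring

theorem stmt19 :
    (∀ (x : ℕ) (y : ℝ), 1 ≤ x → 0 < y → y ≤ 1 →
      y / Real.exp 1 ≤ (1 - 1 / ((x : ℝ) + y)) ^ x) ∧
    IsGLB {t : ℝ | ∃ (x : ℕ) (y : ℝ), 1 ≤ x ∧ 0 < y ∧ y ≤ 1 ∧
        t = (1 - 1 / ((x : ℝ) + y)) ^ x / y} (1 / Real.exp 1) ∧
    (1 / Real.exp 1) ∉ {t : ℝ | ∃ (x : ℕ) (y : ℝ), 1 ≤ x ∧ 0 < y ∧ y ≤ 1 ∧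
        t = (1 - 1 / ((x : ℝ) + y)) ^ x / y} := by
  refine ⟨fun x y hx hy hy1 => (div_exp_one_lt_one_sub_pow hx hy hy1).le, ⟨?_, ?_⟩, ?_⟩
  · rintro t ⟨x, y, hx, hy, hy1, rfl⟩
    exact (one_div_exp_one_lt_one_sub_pow_div hx hy hy1).le
  · intro b hb
    refine ge_of_tendsto tendsto_one_sub_one_div_add_one_pow ?_
    filter_upwards [Filter.eventually_ge_atTop 1] with n hn
    exact hb ⟨n, 1, hn, one_pos, le_rfl, (div_one _).symm⟩
  · rintro ⟨x, y, hx, hy, hy1, h⟩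
    exact (one_div_exp_one_lt_one_sub_pow_div hx hy hy1).ne h
end
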